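/- arXiv:1804.04208 — 5 statements merged into one kernel-verified Lean document; each statement's English description precedes it below -/
import Mathlib

section
/- Let v : ℝ^d → ℝ^d be twice continuously differentiable with v and its first and second derivatives bounded, and fix z₀ ∈ ℝ^d. Then there exist constants C > 0 and h₀ > 0 such that for every step size h ∈ (0, h₀] and every curve w : ℝ → ℝ^d satisfying w(0) = z₀ and, for all t ∈ [0, h], w'(t) = v(w(t)) − (h/2)·Dv(w(t))(v(w(t))) (the modified equation of Euler's method), one has ‖w(h) − (z₀ + h·v(z₀))‖ ≤ C·h³. In other words, Euler's method is a second-order approximation to its lowest-order modified differential equation ż = v(z) − (h/2) v'(z)v(z). -/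
section ModifiedEquation

variable {E : Type*} [NormedAddCommGroup E] [NormedSpace ℝ E]

lemma norm_fderiv_sub_le_of_norm_iteratedFDeriv_two_le {v : E → E} (hv : ContDiff ℝ 2 v) {M : ℝ}
    (hM : ∀ z, ‖iteratedFDeriv ℝ 2 v z‖ ≤ M) (x y : E) :
    ‖fderiv ℝ v x - fderiv ℝ v y‖ ≤ M * ‖x - y‖ := by
  have hd : Differentiable ℝ (fderiv ℝ v) :=
    (hv.fderiv_right (m := 1) (by norm_num)).differentiable (by norm_num)
  refine Convex.norm_image_sub_le_of_norm_fderiv_le (s := Set.univ) (𝕜 := ℝ)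
    (fun z _ => hd z) (fun z _ => ?_) convex_univ (Set.mem_univ y) (Set.mem_univ x)
  rw [← norm_iteratedFDeriv_one, norm_iteratedFDeriv_fderiv]
  exact hM z

lemma norm_sub_le_of_norm_fderiv_le {v : E → E} (hv : Differentiable ℝ v) {M : ℝ}
    (hM : ∀ z, ‖fderiv ℝ v z‖ ≤ M) (x y : E) : ‖v x - v y‖ ≤ M * ‖x - y‖ :=
  Convex.norm_image_sub_le_of_norm_fderiv_le (s := Set.univ) (𝕜 := ℝ)
    (fun z _ => hv z) (fun z _ => hM z) convex_univ (Set.mem_univ y) (Set.mem_univ x)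

lemma norm_fderiv_apply_self_sub_le {v : E → E} (hv : ContDiff ℝ 2 v) {M : ℝ}
    (h₀ : ∀ z, ‖v z‖ ≤ M) (h₁ : ∀ z, ‖fderiv ℝ v z‖ ≤ M)
    (h₂ : ∀ z, ‖iteratedFDeriv ℝ 2 v z‖ ≤ M) (x y : E) :
    ‖fderiv ℝ v x (v x) - fderiv ℝ v y (v y)‖ ≤ 2 * M ^ 2 * ‖x - y‖ := by
  have hsplit : fderiv ℝ v x (v x) - fderiv ℝ v y (v y)
      = (fderiv ℝ v x - fderiv ℝ v y) (v x) + fderiv ℝ v y (v x - v y) := by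
    simp only [sub_apply, map_sub]; abel
  calc _ ≤ ‖(fderiv ℝ v x - fderiv ℝ v y) (v x)‖ + ‖fderiv ℝ v y (v x - v y)‖ :=
        hsplit ▸ norm_add_le _ _
    _ ≤ M * ‖x - y‖ * M + M * (M * ‖x - y‖) := add_le_add
        (ContinuousLinearMap.le_of_opNorm_le_of_le _
          (norm_fderiv_sub_le_of_norm_iteratedFDeriv_two_le hv h₂ x y) (h₀ x))
        (ContinuousLinearMap.le_of_opNorm_le_of_le _ (h₁ y)
          (norm_sub_le_of_norm_fderiv_le (hv.differentiable (by norm_num)) h₁ x y))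
    _ = _ := by ring

lemma norm_sub_euler_step_le_of_modified_equation {v : E → E} (hv : ContDiff ℝ 2 v) {M : ℝ}
    (hM₀ : 0 ≤ M) (h₀ : ∀ z, ‖v z‖ ≤ M) (h₁ : ∀ z, ‖fderiv ℝ v z‖ ≤ M)
    (h₂ : ∀ z, ‖iteratedFDeriv ℝ 2 v z‖ ≤ M) {h : ℝ} (hh : 0 < h) (hh₁ : h ≤ 1) {w : ℝ → E}
    (hw : ∀ t ∈ Set.Icc (0 : ℝ) h,
      HasDerivAt w (v (w t) - (h / 2) • (fderiv ℝ v (w t)) (v (w t))) t) :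
    ‖w h - (w 0 + h • v (w 0))‖ ≤ (3 * M ^ 2 * (M + M ^ 2) + M ^ 3) * h ^ 3 := by
  set F : E → E := fun z => fderiv ℝ v z (v z) with hF
  have hFM (z : E) : ‖F z‖ ≤ M * M :=
    ContinuousLinearMap.le_of_opNorm_le_of_le _ (h₁ z) (h₀ z)
  have hw_le : ∀ t ∈ Set.Icc (0 : ℝ) h, ‖w t - w 0‖ ≤ (M + M ^ 2) * h := by
    intro t ht
    refine (norm_image_sub_le_of_norm_deriv_le_segment' (C := M + M ^ 2)
      (fun s hs => (hw s hs).hasDerivWithinAt) (fun s _ => ?_) t ht).trans ?_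
    · refine (norm_sub_le _ _).trans (add_le_add (h₀ _) ?_)
      rw [norm_smul, Real.norm_of_nonneg (by positivity)]
      nlinarith [hFM (w s), norm_nonneg (F (w s))]
    · rw [sub_zero]; gcongr; exact ht.2
  have hF_le : ∀ t ∈ Set.Icc (0 : ℝ) h, ‖F (w t) - F (w 0)‖ ≤ 2 * M ^ 2 * ((M + M ^ 2) * h) :=
    fun t ht => (norm_fderiv_apply_self_sub_le hv h₀ h₁ h₂ _ _).trans
      (by gcongr; exact hw_le t ht)
  have hv_le : ∀ t ∈ Set.Icc (0 : ℝ) h,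
      ‖v (w t) - v (w 0) - t • F (w 0)‖ ≤ (2 * M ^ 2 * (M + M ^ 2) + M ^ 3) * h * h := by
    intro t ht
    have hderiv : ∀ s ∈ Set.Icc (0 : ℝ) h, HasDerivWithinAt
        (fun s => v (w s) - v (w 0) - s • F (w 0))
        (F (w s) - F (w 0) - (h / 2) • fderiv ℝ v (w s) (F (w s))) (Set.Icc 0 h) s := by
      intro s hs
      have hvw := ((hv.differentiable (by norm_num)) (w s)).hasFDerivAt.comp_hasDerivAt s (hw s hs)
      refine (((hvw.sub_const (v (w 0))).sub
        ((hasDerivAt_id s).smul_const (F (w 0)))).congr_deriv ?_).hasDerivWithinAt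
      simp only [map_sub, map_smul, one_smul, hF]
      abel
    have hmv := norm_image_sub_le_of_norm_deriv_le_segment'
      (C := (2 * M ^ 2 * (M + M ^ 2) + M ^ 3) * h) hderiv (fun s hs => ?_) t ht
    · simp only [sub_self, zero_smul, sub_zero] at hmv
      refine hmv.trans ?_
      gcongr
      exact ht.2
    · have hsecond : ‖fderiv ℝ v (w s) (F (w s))‖ ≤ M * (M * M) :=
        ContinuousLinearMap.le_of_opNorm_le_of_le _ (h₁ _) (hFM _)
      refine (norm_sub_le _ _).trans ?_
      rw [norm_smul, Real.norm_of_nonneg (by positivity)]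
      have hfirst := hF_le s (Set.Ico_subset_Icc_self hs)
      nlinarith [mul_le_mul_of_nonneg_left hsecond hh.le, mul_nonneg hh.le (pow_nonneg hM₀ 3)]
  have hderiv : ∀ t ∈ Set.Icc (0 : ℝ) h, HasDerivWithinAt
      (fun t => w t - t • v (w 0) - (t ^ 2 / 2 - h / 2 * t) • F (w 0))
      ((v (w t) - v (w 0) - t • F (w 0)) - (h / 2) • (F (w t) - F (w 0))) (Set.Icc 0 h) t := by
    intro t ht
    have hq : HasDerivAt (fun t : ℝ => t ^ 2 / 2 - h / 2 * t) (t - h / 2) t := by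
      refine (((hasDerivAt_pow 2 t).div_const 2).sub
        ((hasDerivAt_id t).const_mul (h / 2))).congr_deriv ?_
      norm_num
    refine ((((hw t ht).sub ((hasDerivAt_id t).smul_const (v (w 0)))).sub
      (hq.smul_const (F (w 0)))).congr_deriv ?_).hasDerivWithinAt
    simp only [hF]
    module
  have hmv := norm_image_sub_le_of_norm_deriv_le_segment'
    (C := (3 * M ^ 2 * (M + M ^ 2) + M ^ 3) * h ^ 2) hderiv (fun t ht => ?_) h
    (Set.right_mem_Icc.2 hh.le)
  · have hend : h ^ 2 / 2 - h / 2 * h = 0 := by ring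
    simp only [hend, zero_smul, sub_zero, ne_eq, OfNat.ofNat_ne_zero, not_false_eq_true, zero_pow,
      zero_div, mul_zero] at hmv
    convert hmv using 1
    · congr 1; abel
    · ring
  · have ht' := Set.Ico_subset_Icc_self ht
    refine (norm_sub_le _ _).trans ?_
    rw [norm_smul, Real.norm_of_nonneg (by positivity)]
    nlinarith [hv_le t ht', mul_le_mul_of_nonneg_left (hF_le t ht') hh.le]

end ModifiedEquation


/-- Euler's method is a second-order approximation to its lowest-order modified
equation `ż = v(z) - (h/2) v'(z) v(z)`. -/
theorem euler_second_order_for_modified_equation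
    {d : ℕ} (v : EuclideanSpace ℝ (Fin d) → EuclideanSpace ℝ (Fin d))
    (z₀ : EuclideanSpace ℝ (Fin d))
    (hv : ContDiff ℝ 2 v)
    (hbdd : ∃ M : ℝ, ∀ z, ‖v z‖ ≤ M ∧ ‖fderiv ℝ v z‖ ≤ M ∧ ‖iteratedFDeriv ℝ 2 v z‖ ≤ M) :
    ∃ C > (0:ℝ), ∃ h₀ > (0:ℝ), ∀ h ∈ Set.Ioc (0:ℝ) h₀,
      ∀ w : ℝ → EuclideanSpace ℝ (Fin d), w 0 = z₀ →
        (∀ t ∈ Set.Icc (0:ℝ) h,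
          HasDerivAt w (v (w t) - (h / 2) • (fderiv ℝ v (w t)) (v (w t))) t) →
        ‖w h - (z₀ + h • v z₀)‖ ≤ C * h ^ 3 := by
  obtain ⟨M, hM⟩ := hbdd
  have hM₀ : 0 ≤ M := (norm_nonneg _).trans (hM z₀).1
  refine ⟨3 * M ^ 2 * (M + M ^ 2) + M ^ 3 + 1, by positivity, 1, one_pos, ?_⟩
  rintro h ⟨hh, hh₁⟩ w rfl hw
  refine (norm_sub_euler_step_le_of_modified_equation hv hM₀ (fun z => (hM z).1)
    (fun z => (hM z).2.1) (fun z => (hM z).2.2) hh hh₁ hw).trans ?_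
  exact mul_le_mul_of_nonneg_right (le_add_of_nonneg_right zero_le_one) (by positivity)
end

section
/- Let v : ℝ^d → ℝ^d be three times continuously differentiable with v and its derivatives up to order three bounded, and fix z₀ ∈ ℝ^d. Define the Heun step Ψ_h(z₀) = z₀ + (h/2)·[v(z₀) + v(z₀ + h·v(z₀))]. Then there exist constants C > 0 and h₀ > 0 such that for every h ∈ (0, h₀] and every curve w : ℝ → ℝ^d satisfying w(0) = z₀ and, for all t ∈ [0, h], w'(t) = v(w(t)) + (h²/12)·[D²v(w(t))(v(w(t)), v(w(t))) − 2·Dv(w(t))(Dv(w(t))(v(w(t))))], one has ‖w(h) − Ψ_h(z₀)‖ ≤ C·h⁴. In other words, the second-order Runge–Kutta (Heun) method is a third-order approximation to its lowest-order modified differential equation ż = v + (h²/12)(v''(v,v) − 2 v'v'v). -/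
open Set Filter Topology

section HeunHelpers

variable {E : Type*} [NormedAddCommGroup E] [NormedSpace ℝ E]

theorem norm_sub_le_mul_of_hasDerivAt_Icc {f f' : ℝ → E} {h C : ℝ}
    (hf : ∀ t ∈ Icc (0 : ℝ) h, HasDerivAt f (f' t) t)
    (hC : ∀ t ∈ Icc (0 : ℝ) h, ‖f' t‖ ≤ C) :
    ∀ t ∈ Icc (0 : ℝ) h, ‖f t - f 0‖ ≤ C * h := by
  intro t ht
  have hC0 : 0 ≤ C := (norm_nonneg _).trans (hC t ht)
  have key := norm_image_sub_le_of_norm_deriv_le_segment'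
    (fun x hx => (hf x hx).hasDerivWithinAt) (fun x hx => hC x (Ico_subset_Icc_self hx)) t ht
  rw [sub_zero] at key
  exact key.trans (mul_le_mul_of_nonneg_left ht.2 hC0)

/-- Second-order Taylor expansion of a curve `p` whose derivative is `q` up to a perturbation of
size `h ^ 2`. -/
theorem norm_taylor_two_le_of_perturbed_deriv {p q e r : ℝ → E} {r₀ : E} {h C D : ℝ}
    (hp : ∀ t ∈ Icc (0 : ℝ) h, HasDerivAt p (q t + e t) t)
    (hq : ∀ t ∈ Icc (0 : ℝ) h, HasDerivAt q (r t) t)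
    (hr : ∀ t ∈ Icc (0 : ℝ) h, ‖r t - r₀‖ ≤ C * h)
    (he : ∀ t ∈ Icc (0 : ℝ) h, ‖e t‖ ≤ D * h ^ 2) :
    ∀ t ∈ Icc (0 : ℝ) h,
      ‖p t - (p 0 + t • q 0 + (t ^ 2 / 2) • r₀)‖ ≤ (C + D) * h ^ 3 := by
  have hq_bound : ∀ t ∈ Icc (0 : ℝ) h, ‖q t - (q 0 + t • r₀)‖ ≤ C * h ^ 2 := by
    intro t ht
    have := norm_sub_le_mul_of_hasDerivAt_Icc (f := fun t => q t - t • r₀) (f' := fun t => r t - r₀)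
      (fun t ht => ((hq t ht).sub ((hasDerivAt_id t).smul_const r₀)).congr_deriv (by simp)) hr t ht
    convert this using 1
    · congr 1; module
    · ring
  intro t ht
  have := norm_sub_le_mul_of_hasDerivAt_Icc
    (f := fun t => p t - (t • q 0 + (t ^ 2 / 2) • r₀))
    (f' := fun t => (q t - (q 0 + t • r₀)) + e t) (C := (C + D) * h ^ 2)
    (fun t ht => by
      have h1 := (hasDerivAt_id t).smul_const (q 0)
      have h2 := (((hasDerivAt_id t).pow 2).div_const 2).smul_const r₀
      refine ((hp t ht).sub (h1.add h2)).congr_deriv ?_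
      simp only [id]
      norm_num
      module)
    (fun t ht => (norm_add_le _ _).trans (by linarith [hq_bound t ht, he t ht])) t ht
  convert this using 1
  · congr 1; simp; module
  · ring

theorem exists_eventually_norm_sub_le_mul {F : Type*} [NormedAddCommGroup F] [NormedSpace ℝ F]
    {f : E → F} {z₀ : E} (hf : DifferentiableAt ℝ f z₀) :
    ∃ L > (0 : ℝ), ∀ᶠ z in 𝓝 z₀, ‖f z - f z₀‖ ≤ L * ‖z - z₀‖ :=
  hf.isBigO_sub.exists_pos.imp fun _ hL => ⟨hL.1, hL.2.bound⟩

theorem exists_eventually_norm_le {X F : Type*} [TopologicalSpace X] [NormedAddCommGroup F]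
    {f : X → F} {z₀ : X} (hf : ContinuousAt f z₀) :
    ∃ L > (0 : ℝ), ∀ᶠ z in 𝓝 z₀, ‖f z‖ ≤ L :=
  ⟨‖f z₀‖ + 1, by positivity,
    (hf.norm.eventually_lt_const (lt_add_one _)).mono fun _ hz => hz.le⟩

/-- The correction term of the modified equation of Heun's method. -/
noncomputable def heunCorrection (v : E → E) (z : E) : E :=
  iteratedFDeriv ℝ 2 v z ![v z, v z] - (2 : ℝ) • fderiv ℝ v z (fderiv ℝ v z (v z))

theorem heunCorrection_eq (v : E → E) (z : E) :
    heunCorrection v z =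
      fderiv ℝ (fderiv ℝ v) z (v z) (v z) - (2 : ℝ) • fderiv ℝ v z (fderiv ℝ v z (v z)) := by
  simp [heunCorrection, iteratedFDeriv_two_apply]

theorem contDiff_heunCorrection {v : E → E} (hv : ContDiff ℝ 3 v) :
    ContDiff ℝ 1 (heunCorrection v) := by
  have h1 : ContDiff ℝ 2 (fderiv ℝ v) := hv.fderiv_right (by norm_num)
  have h2 : ContDiff ℝ 1 (fderiv ℝ (fderiv ℝ v)) := h1.fderiv_right (by norm_num)
  have hv' : ContDiff ℝ 1 v := hv.of_le (by norm_num)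
  have h1' : ContDiff ℝ 1 (fderiv ℝ v) := h1.of_le (by norm_num)
  rw [funext (heunCorrection_eq v)]
  exact ((h2.clm_apply hv').clm_apply hv').sub
    (contDiff_const.smul (h1'.clm_apply (h1'.clm_apply hv')))

theorem norm_heunCorrection_le {v : E → E} {M : ℝ} {z : E} (h0 : ‖v z‖ ≤ M)
    (h1 : ‖fderiv ℝ v z‖ ≤ M) (h2 : ‖iteratedFDeriv ℝ 2 v z‖ ≤ M) :
    ‖heunCorrection v z‖ ≤ 3 * M ^ 3 := by
  have hM : 0 ≤ M := (norm_nonneg _).trans h0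
  have hB : ‖iteratedFDeriv ℝ 2 v z ![v z, v z]‖ ≤ M * (M * M) := by
    refine ((iteratedFDeriv ℝ 2 v z).le_opNorm _).trans ?_
    simp only [Fin.prod_univ_two, Matrix.cons_val_zero, Matrix.cons_val_one]
    gcongr
  have hA : ‖fderiv ℝ v z (fderiv ℝ v z (v z))‖ ≤ M * (M * M) :=
    (fderiv ℝ v z).le_of_opNorm_le_of_le h1 ((fderiv ℝ v z).le_of_opNorm_le_of_le h1 h0)
  refine (norm_sub_le _ _).trans ?_
  rw [norm_smul, Real.norm_ofNat]
  linarith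

/-- Taylor expansion of the intermediate stage of Heun's method. -/
theorem exists_norm_taylor_two_line_le {v : E → E} (hv : ContDiff ℝ 3 v) (z₀ u : E) :
    ∃ C > (0 : ℝ), ∃ h₀ > (0 : ℝ), ∀ h ∈ Ioc (0 : ℝ) h₀,
      ‖v (z₀ + h • u) - (v z₀ + h • fderiv ℝ v z₀ u +
        (h ^ 2 / 2) • fderiv ℝ (fderiv ℝ v) z₀ u u)‖ ≤ C * h ^ 3 := by
  have h1 : ContDiff ℝ 2 (fderiv ℝ v) := hv.fderiv_right (by norm_num)
  have h2 : ContDiff ℝ 1 (fderiv ℝ (fderiv ℝ v)) := h1.fderiv_right (by norm_num)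
  have hr : ContDiff ℝ 1 fun z => fderiv ℝ (fderiv ℝ v) z u u :=
    (h2.clm_apply contDiff_const).clm_apply contDiff_const
  obtain ⟨L, hL, hLz⟩ := exists_eventually_norm_sub_le_mul
    (hr.differentiable (by norm_num) z₀)
  obtain ⟨δ, hδ, hball⟩ := Metric.eventually_nhds_iff.1 hLz
  refine ⟨L * (‖u‖ + 1), by positivity, δ / (‖u‖ + 1), by positivity, fun h hh => ?_⟩
  have hh0 := hh.1
  have hsmall : h * (‖u‖ + 1) ≤ δ := (le_div_iff₀ (by positivity)).1 hh.2
  have hline (t : ℝ) : HasDerivAt (fun t : ℝ => z₀ + t • u) u t := by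
    simpa using ((hasDerivAt_id t).smul_const u).const_add z₀
  have key := norm_taylor_two_le_of_perturbed_deriv (h := h) (D := 0) (C := L * (‖u‖ + 1))
    (p := fun t => v (z₀ + t • u)) (q := fun t => fderiv ℝ v (z₀ + t • u) u) (e := fun _ => 0)
    (r := fun t => fderiv ℝ (fderiv ℝ v) (z₀ + t • u) u u)
    (r₀ := fderiv ℝ (fderiv ℝ v) z₀ u u)
    (fun t _ => (((hv.differentiable (by norm_num) _).hasFDerivAt).comp_hasDerivAt t
      (hline t)).congr_deriv (by simp))
    (fun t _ => by
      simpa using (((h1.differentiable (by norm_num) _).hasFDerivAt).comp_hasDerivAt t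
        (hline t)).clm_apply (hasDerivAt_const t u))
    (fun t ht => by
      have hd : ‖(z₀ + t • u) - z₀‖ ≤ h * ‖u‖ := by
        rw [add_sub_cancel_left, norm_smul, Real.norm_of_nonneg ht.1]
        exact mul_le_mul_of_nonneg_right ht.2 (norm_nonneg _)
      have hlt : dist (z₀ + t • u) z₀ < δ := by
        rw [dist_eq_norm]; linarith
      refine (hball hlt).trans ?_
      calc L * ‖(z₀ + t • u) - z₀‖ ≤ L * (h * (‖u‖ + 1)) := by
            gcongr
            linarith
        _ = L * (‖u‖ + 1) * h := by ring)
    (fun t _ => by simp) h ⟨hh0.le, le_rfl⟩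
  simpa using key

/-- Taylor expansion of solutions of a perturbed equation `w' = v(w) + (h² / 12) g(w)` that have
bounded speed, uniformly in the solution. -/
theorem exists_norm_taylor_three_le_of_perturbed_ode {v g : E → E} (hv : ContDiff ℝ 3 v)
    (hg : ContDiff ℝ 1 g) (z₀ : E) {K : ℝ} (hK : 0 < K)
    (hbound : ∀ z, ‖v z‖ + ‖g z‖ ≤ K) :
    ∃ C > (0 : ℝ), ∃ h₀ > (0 : ℝ), ∀ h ∈ Ioc (0 : ℝ) h₀, ∀ w : ℝ → E, w 0 = z₀ →
      (∀ t ∈ Icc (0 : ℝ) h, HasDerivAt w (v (w t) + (h ^ 2 / 12) • g (w t)) t) →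
      ‖w h - (z₀ + h • v z₀ + (h ^ 2 / 2) • fderiv ℝ v z₀ (v z₀) +
        (h ^ 3 / 6) • (fderiv ℝ (fderiv ℝ v) z₀ (v z₀) (v z₀) +
          fderiv ℝ v z₀ (fderiv ℝ v z₀ (v z₀))) +
        (h ^ 3 / 12) • g z₀)‖ ≤ C * h ^ 4 := by
  have h1 : ContDiff ℝ 2 (fderiv ℝ v) := hv.fderiv_right (by norm_num)
  set k : E → E := fun z => fderiv ℝ v z (v z) with hk
  have hkC : ContDiff ℝ 2 k := h1.clm_apply (hv.of_le (by norm_num))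
  have hkC' : ContDiff ℝ 1 (fderiv ℝ k) := hkC.fderiv_right (by norm_num)
  set m : E → E := fun z => fderiv ℝ k z (v z) with hm
  have hmC : ContDiff ℝ 1 m := hkC'.clm_apply (hv.of_le (by norm_num))
  have hm0 : m z₀ = fderiv ℝ (fderiv ℝ v) z₀ (v z₀) (v z₀) +
      fderiv ℝ v z₀ (fderiv ℝ v z₀ (v z₀)) := by
    have := ((h1.differentiable (by norm_num) z₀).hasFDerivAt).clm_apply
      (hv.differentiable (by norm_num) z₀).hasFDerivAt
    simp only [hm, hk]
    rw [this.fderiv]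
    simp [add_comm]
  obtain ⟨Lg, hLg, hg_ev⟩ := exists_eventually_norm_sub_le_mul
    (hg.differentiable (by norm_num) z₀)
  obtain ⟨Lm, hLm, hm_ev⟩ := exists_eventually_norm_sub_le_mul
    (hmC.differentiable (by norm_num) z₀)
  obtain ⟨B, hB, hB_ev⟩ := exists_eventually_norm_le (z₀ := z₀)
    (h1.continuous.clm_apply hg.continuous).continuousAt
  obtain ⟨B', hB', hB'_ev⟩ := exists_eventually_norm_le (z₀ := z₀)
    (hkC'.continuous.clm_apply hg.continuous).continuousAt
  obtain ⟨δ, hδ, hball⟩ := Metric.eventually_nhds_iff.1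
    (hg_ev.and (hm_ev.and (hB_ev.and hB'_ev)))
  refine ⟨Lm * K + B' + B + Lg * K, by positivity, min 1 (δ / (2 * K)), by positivity,
    fun h hh w hw0 hw => ?_⟩
  have hh0 := hh.1
  have hh1 : h ≤ 1 := hh.2.trans (min_le_left _ _)
  have hhδ : h * (2 * K) ≤ δ := (le_div_iff₀ (by positivity)).1 (hh.2.trans (min_le_right _ _))
  have hsq : h ^ 2 ≤ h := by nlinarith
  have hsmul (x : E) : ‖(h ^ 2 / 12) • x‖ ≤ h ^ 2 * ‖x‖ := by
    rw [norm_smul, Real.norm_of_nonneg (by positivity)]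
    gcongr
    linarith [sq_nonneg h]
  have hdist : ∀ t ∈ Icc (0 : ℝ) h, ‖w t - z₀‖ ≤ K * h := by
    rw [← hw0]
    refine norm_sub_le_mul_of_hasDerivAt_Icc hw fun t _ => ?_
    have : h ^ 2 * ‖g (w t)‖ ≤ 1 * ‖g (w t)‖ := by gcongr; linarith
    linarith [norm_add_le (v (w t)) ((h ^ 2 / 12) • g (w t)), hsmul (g (w t)), hbound (w t)]
  have hnear : ∀ t ∈ Icc (0 : ℝ) h, dist (w t) z₀ < δ := fun t ht => by
    rw [dist_eq_norm]
    nlinarith [hdist t ht, mul_pos hK hh0]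
  have hvw := norm_taylor_two_le_of_perturbed_deriv (h := h) (C := Lm * K + B') (D := B)
    (p := fun t => v (w t)) (q := fun t => k (w t))
    (e := fun t => (h ^ 2 / 12) • fderiv ℝ v (w t) (g (w t)))
    (r := fun t => m (w t) + (h ^ 2 / 12) • fderiv ℝ k (w t) (g (w t))) (r₀ := m z₀)
    (fun t ht => (((hv.differentiable (by norm_num) _).hasFDerivAt).comp_hasDerivAt t
      (hw t ht)).congr_deriv (by simp [hk]))
    (fun t ht => (((hkC.differentiable (by norm_num) _).hasFDerivAt).comp_hasDerivAt t
      (hw t ht)).congr_deriv (by simp [hm]))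
    (fun t ht => by
      obtain ⟨-, e2, -, e4⟩ := hball (hnear t ht)
      rw [add_sub_right_comm]
      calc _ ≤ ‖m (w t) - m z₀‖ + ‖(h ^ 2 / 12) • fderiv ℝ k (w t) (g (w t))‖ := norm_add_le _ _
        _ ≤ Lm * (K * h) + h * B' := by
            refine add_le_add (e2.trans ?_) ((hsmul _).trans ?_)
            · have := hdist t ht
              gcongr
            · gcongr
        _ = _ := by ring)
    (fun t ht => by
      obtain ⟨-, -, e3, -⟩ := hball (hnear t ht)
      refine (hsmul _).trans ?_
      rw [mul_comm]
      gcongr)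
  have key := norm_sub_le_mul_of_hasDerivAt_Icc (h := h)
    (f := fun t => w t - (t • v z₀ + (t ^ 2 / 2) • k z₀ + (t ^ 3 / 6) • m z₀ +
      t • (h ^ 2 / 12) • g z₀))
    (f' := fun t => (v (w t) - (v z₀ + t • k z₀ + (t ^ 2 / 2) • m z₀)) +
      (h ^ 2 / 12) • (g (w t) - g z₀)) (C := (Lm * K + B' + B + Lg * K) * h ^ 3)
    (fun t ht => by
      have d1 := (hasDerivAt_id t).smul_const (v z₀)
      have d2 := (((hasDerivAt_id t).pow 2).div_const 2).smul_const (k z₀)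
      have d3 := (((hasDerivAt_id t).pow 3).div_const 6).smul_const (m z₀)
      have d4 := (hasDerivAt_id t).smul_const ((h ^ 2 / 12) • g z₀)
      refine ((hw t ht).sub (((d1.add d2).add d3).add d4)).congr_deriv ?_
      simp only [id]
      norm_num
      module)
    (fun t ht => by
      have e0 := hvw t ht
      simp only [hw0] at e0
      have e1 := (hball (hnear t ht)).1
      calc _ ≤ _ := norm_add_le _ _
        _ ≤ (Lm * K + B' + B) * h ^ 3 + h ^ 2 * (Lg * (K * h)) := by
            refine add_le_add e0 ((hsmul _).trans ?_)
            have := hdist t ht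
            gcongr
            exact e1.trans (by gcongr)
        _ = _ := by ring)
    h ⟨hh0.le, le_rfl⟩
  rw [← hm0]
  convert key using 1
  · congr 1
    simp [hw0]
    module
  · ring

end HeunHelpers


/-- Heun's method (explicit second-order Runge--Kutta) is a third-order approximation
to its lowest-order modified equation `ż = v + (h²/12)(v''(v,v) - 2 v'v'v)`. -/
theorem heun_third_order_for_modified_equation
    {d : ℕ} (v : EuclideanSpace ℝ (Fin d) → EuclideanSpace ℝ (Fin d))
    (z₀ : EuclideanSpace ℝ (Fin d))
    (hv : ContDiff ℝ 3 v)
    (hbdd : ∃ M : ℝ, ∀ z, ‖v z‖ ≤ M ∧ ‖fderiv ℝ v z‖ ≤ M ∧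
      ‖iteratedFDeriv ℝ 2 v z‖ ≤ M ∧ ‖iteratedFDeriv ℝ 3 v z‖ ≤ M) :
    ∃ C > (0:ℝ), ∃ h₀ > (0:ℝ), ∀ h ∈ Set.Ioc (0:ℝ) h₀,
      ∀ w : ℝ → EuclideanSpace ℝ (Fin d), w 0 = z₀ →
        (∀ t ∈ Set.Icc (0:ℝ) h,
          HasDerivAt w
            (v (w t) + (h ^ 2 / 12) •
              (iteratedFDeriv ℝ 2 v (w t) ![v (w t), v (w t)]
                - (2:ℝ) • (fderiv ℝ v (w t)) ((fderiv ℝ v (w t)) (v (w t))))) t) →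
        ‖w h - (z₀ + (h / 2) • (v z₀ + v (z₀ + h • v z₀)))‖ ≤ C * h ^ 4 := by
  obtain ⟨M, hM⟩ := hbdd
  have hM0 : 0 ≤ M := (norm_nonneg _).trans (hM z₀).1
  obtain ⟨C₁, hC₁, h₁, hh₁, H₁⟩ := exists_norm_taylor_three_le_of_perturbed_ode hv
    (contDiff_heunCorrection hv) z₀ (K := M + 3 * M ^ 3 + 1) (by positivity) fun z => by
      obtain ⟨b0, b1, b2, -⟩ := hM z
      linarith [norm_heunCorrection_le b0 b1 b2]
  obtain ⟨C₂, hC₂, h₂, hh₂, H₂⟩ := exists_norm_taylor_two_line_le hv z₀ (v z₀)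
  refine ⟨C₁ + C₂, by positivity, min h₁ h₂, lt_min hh₁ hh₂, fun h hh w hw0 hw => ?_⟩
  have hh0 := hh.1
  have e₁ := H₁ h ⟨hh0, hh.2.trans (min_le_left _ _)⟩ w hw0 hw
  have e₂ := H₂ h ⟨hh0, hh.2.trans (min_le_right _ _)⟩
  rw [heunCorrection_eq] at e₁
  set a := fderiv ℝ v z₀ (v z₀)
  set b := fderiv ℝ v z₀ a
  set c := fderiv ℝ (fderiv ℝ v) z₀ (v z₀) (v z₀)
  set y := v (z₀ + h • v z₀)
  calc ‖w h - (z₀ + (h / 2) • (v z₀ + y))‖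
      = ‖(w h - (z₀ + h • v z₀ + (h ^ 2 / 2) • a + (h ^ 3 / 6) • (c + b) +
          (h ^ 3 / 12) • (c - (2 : ℝ) • b))) -
          (h / 2) • (y - (v z₀ + h • a + (h ^ 2 / 2) • c))‖ := by
        congr 1
        module
    _ ≤ C₁ * h ^ 4 + h * (C₂ * h ^ 3) := by
        refine (norm_sub_le _ _).trans (add_le_add e₁ ?_)
        rw [norm_smul, Real.norm_of_nonneg (by positivity)]
        gcongr
        linarith
    _ = (C₁ + C₂) * h ^ 4 := by ring
end

section
/- Let v : ℝ^d → ℝ^d be three times continuously differentiable with v and its derivatives up to order three bounded, and fix z₀ ∈ ℝ^d. Define the second-order Taylor step T_h(z₀) = z₀ + h·v(z₀) + (h²/2)·Dv(z₀)(v(z₀)). Then there exist constants C > 0 and h₀ > 0 such that for every h ∈ (0, h₀] and every curve w : ℝ → ℝ^d satisfying w(0) = z₀ and, for all t ∈ [0, h], w'(t) = v(w(t)) − (h²/6)·[D²v(w(t))(v(w(t)), v(w(t))) + Dv(w(t))(Dv(w(t))(v(w(t))))], one has ‖w(h) − T_h(z₀)‖ ≤ C·h⁴. In other words, the second-order Taylor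 method is a third-order approximation to its lowest-order modified differential equation ż = v − (h²/6)(v''(v,v) + v'v'v). -/
/-- A function that is bounded and Lipschitz, with a common constant. -/
def IsBoundedLipschitz {E F : Type*} [NormedAddCommGroup E] [NormedAddCommGroup F]
    (f : E → F) : Prop :=
  ∃ K : ℝ, 0 ≤ K ∧ (∀ x, ‖f x‖ ≤ K) ∧ ∀ x y, ‖f x - f y‖ ≤ K * ‖x - y‖

namespace IsBoundedLipschitz

variable {E F G : Type*} [NormedAddCommGroup E] [NormedAddCommGroup F] [NormedAddCommGroup G]

theorem of_fderiv [NormedSpace ℝ E] [NormedSpace ℝ F] {f : E → F} {M : ℝ}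
    (hf : Differentiable ℝ f) (hM : ∀ x, ‖f x‖ ≤ M) (hM' : ∀ x, ‖fderiv ℝ f x‖ ≤ M) :
    IsBoundedLipschitz f :=
  ⟨M, (norm_nonneg _).trans (hM 0), hM, fun _ _ =>
    convex_univ.norm_image_sub_le_of_norm_fderiv_le (fun z _ => hf z) (fun z _ => hM' z)
      (Set.mem_univ _) (Set.mem_univ _)⟩

theorem fderiv_fderiv [NormedSpace ℝ E] [NormedSpace ℝ F] {f : E → F} {M : ℝ}
    (hf : ContDiff ℝ 3 f) (hM : ∀ x, ‖iteratedFDeriv ℝ 2 f x‖ ≤ M)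
    (hM' : ∀ x, ‖iteratedFDeriv ℝ 3 f x‖ ≤ M) :
    IsBoundedLipschitz (fderiv ℝ (fderiv ℝ f)) := by
  have hA : ContDiff ℝ 2 (fderiv ℝ f) := hf.fderiv_right (by norm_num)
  refine of_fderiv (M := M)
    ((hA.fderiv_right (m := 1) (by norm_num)).differentiable (by norm_num))
    (fun z => ?_) fun z => ?_
  · rw [← norm_iteratedFDeriv_one, norm_iteratedFDeriv_fderiv]
    exact hM z
  · rw [← norm_iteratedFDeriv_one, norm_iteratedFDeriv_fderiv, norm_iteratedFDeriv_fderiv]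
    exact hM' z

theorem add {f g : E → F} (hf : IsBoundedLipschitz f) (hg : IsBoundedLipschitz g) :
    IsBoundedLipschitz fun x => f x + g x := by
  obtain ⟨K, hK, hfK, hfL⟩ := hf
  obtain ⟨L, hL, hgK, hgL⟩ := hg
  refine ⟨K + L, add_nonneg hK hL, fun x => norm_add_le_of_le (hfK x) (hgK x), fun x y => ?_⟩
  rw [add_sub_add_comm, add_mul]
  exact norm_add_le_of_le (hfL x y) (hgL x y)

theorem clm_apply [NormedSpace ℝ F] [NormedSpace ℝ G] {P : E → F →L[ℝ] G} {q : E → F}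
    (hP : IsBoundedLipschitz P) (hq : IsBoundedLipschitz q) :
    IsBoundedLipschitz fun x => P x (q x) := by
  obtain ⟨K, hK, hPK, hPL⟩ := hP
  obtain ⟨L, hL, hqK, hqL⟩ := hq
  have hKL : 0 ≤ K * L := mul_nonneg hK hL
  refine ⟨2 * (K * L), by positivity, fun x => ?_, fun x y => ?_⟩
  · have := (P x).le_of_opNorm_le_of_le (hPK x) (hqK x)
    linarith
  · have h₁ := (P x).le_of_opNorm_le_of_le (hPK x) (hqL x y)
    have h₂ := (P x - P y).le_of_opNorm_le_of_le (hPL x y) (hqK y)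
    have h : P x (q x) - P y (q y) = P x (q x - q y) + (P x - P y) (q y) := by
      simp
    rw [h]
    exact (norm_add_le_of_le h₁ h₂).trans_eq (by ring)

end IsBoundedLipschitz

/-- If the derivative of a curve stays within `C` of the derivative of a reference curve, the
increments of the two curves differ by at most `C * h`. -/
theorem norm_sub_sub_le_of_hasDerivAt {E : Type*} [NormedAddCommGroup E] [NormedSpace ℝ E]
    {u p u' p' : ℝ → E} {h C : ℝ} (hC : 0 ≤ C)
    (hu : ∀ t ∈ Set.Icc 0 h, HasDerivAt u (u' t) t)
    (hp : ∀ t ∈ Set.Icc 0 h, HasDerivAt p (p' t) t)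
    (hup : ∀ t ∈ Set.Icc 0 h, ‖u' t - p' t‖ ≤ C) {t : ℝ} (ht : t ∈ Set.Icc 0 h) :
    ‖(u t - p t) - (u 0 - p 0)‖ ≤ C * h := by
  have := norm_image_sub_le_of_norm_deriv_le_segment'
    (f := fun s => u s - p s) (f' := fun s => u' s - p' s)
    (fun s hs => ((hu s hs).sub (hp s hs)).hasDerivWithinAt)
    (fun s hs => hup s (Set.Ico_subset_Icc_self hs)) t ht
  refine this.trans ?_
  rw [sub_zero]
  exact mul_le_mul_of_nonneg_left ht.2 hC

/-- Comparison of the second-order Taylor step with a solution of the modification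
of `v` given by `v(w) - (h² / 6) g(w)`, where `F = Dv v` and `g = DF v`. -/
theorem norm_sub_taylor_le {E : Type*} [NormedAddCommGroup E] [NormedSpace ℝ E]
    {v F g : E → E} {A B : E → E →L[ℝ] E} {K : ℝ} (hK : 0 ≤ K)
    (hA : ∀ z, HasFDerivAt v (A z) z) (hB : ∀ z, HasFDerivAt F (B z) z)
    (hAv : ∀ z, A z (v z) = F z) (hBv : ∀ z, B z (v z) = g z)
    (hvK : ∀ z, ‖v z‖ ≤ K) (hAK : ∀ z, ‖A z‖ ≤ K) (hBK : ∀ z, ‖B z‖ ≤ K)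
    (hgK : ∀ z, ‖g z‖ ≤ K) (hgL : ∀ x y, ‖g x - g y‖ ≤ K * ‖x - y‖)
    {h : ℝ} (h0 : 0 ≤ h) (h1 : h ≤ 1) {w : ℝ → E}
    (hw : ∀ t ∈ Set.Icc 0 h, HasDerivAt w (v (w t) - (h ^ 2 / 6) • g (w t)) t) :
    ‖w h - (w 0 + h • v (w 0) + (h ^ 2 / 2) • F (w 0))‖ ≤ 6 * K ^ 2 * h ^ 4 := by
  have hε : 0 ≤ h ^ 2 / 6 := by positivity
  have hh2 : h ^ 2 ≤ h := by nlinarith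
  have hεn : ∀ x : E, ‖(h ^ 2 / 6) • x‖ = h ^ 2 / 6 * ‖x‖ := fun x => by
    rw [norm_smul, Real.norm_of_nonneg hε]
  have hK2 : 0 ≤ K ^ 2 := sq_nonneg K
  have hAg : ∀ z, ‖(h ^ 2 / 6) • A z (g z)‖ ≤ K ^ 2 * h ^ 2 := fun z => by
    rw [hεn]
    have := (A z).le_of_opNorm_le_of_le (hAK z) (hgK z)
    nlinarith [mul_le_mul_of_nonneg_left this hε, mul_nonneg hK2 hε]
  have hBg : ∀ z, ‖(h ^ 2 / 6) • B z (g z)‖ ≤ K ^ 2 * h := fun z => by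
    rw [hεn]
    have := (B z).le_of_opNorm_le_of_le (hBK z) (hgK z)
    nlinarith [mul_le_mul_of_nonneg_left this hε, mul_nonneg hK2 hε,
      mul_le_mul_of_nonneg_left hh2 hK2]
  have hwbound : ∀ t ∈ Set.Icc 0 h, ‖w t - w 0‖ ≤ 2 * K * h := fun t ht => by
    have := norm_sub_sub_le_of_hasDerivAt (C := 2 * K) (p := fun _ => 0) (p' := fun _ => 0)
      (by positivity) hw (fun t _ => hasDerivAt_const t 0) (fun s _ => by
        rw [sub_zero]
        refine (norm_sub_le_of_le (hvK _) (hεn _).le).trans ?_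
        nlinarith [mul_le_mul_of_nonneg_left (hgK (w s)) hε]) ht
    simpa using this
  have hg : ∀ t ∈ Set.Icc 0 h, ‖g (w t) - g (w 0)‖ ≤ 2 * K ^ 2 * h := fun t ht =>
    (hgL _ _).trans ((mul_le_mul_of_nonneg_left (hwbound t ht) hK).trans_eq (by ring))
  have hF : ∀ t ∈ Set.Icc 0 h, ‖F (w t) - (F (w 0) + t • g (w 0))‖ ≤ 3 * K ^ 2 * h ^ 2 :=
    fun t ht => by
    have := norm_sub_sub_le_of_hasDerivAt (C := 3 * K ^ 2 * h)
      (u := fun t => F (w t)) (p := fun t => t • g (w 0)) (by positivity)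
      (fun s hs => (hB (w s)).comp_hasDerivAt s (hw s hs))
      (fun s _ => (hasDerivAt_id s).smul_const (g (w 0))) (fun s hs => by
        rw [map_sub, map_smul, hBv, one_smul, sub_right_comm]
        exact (norm_sub_le_of_le (hg s hs) (hBg _)).trans_eq (by ring)) ht
    convert this using 1
    · congr 1
      simp only [zero_smul]
      abel
    · ring
  have hv : ∀ t ∈ Set.Icc 0 h,
      ‖v (w t) - (v (w 0) + t • F (w 0) + (t ^ 2 / 2) • g (w 0))‖ ≤ 4 * K ^ 2 * h ^ 3 :=
    fun t ht => by
    have := norm_sub_sub_le_of_hasDerivAt (C := 4 * K ^ 2 * h ^ 2)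
      (u := fun t => v (w t)) (p := fun t => t • F (w 0) + (t ^ 2 / 2) • g (w 0))
      (by positivity)
      (fun s hs => (hA (w s)).comp_hasDerivAt s (hw s hs))
      (fun s _ => ((hasDerivAt_id s).smul_const (F (w 0))).add
        (((hasDerivAt_pow 2 s).div_const 2).smul_const (g (w 0)))) (fun s hs => by
        have e : A (w s) (v (w s) - (h ^ 2 / 6) • g (w s)) -
            ((1 : ℝ) • F (w 0) + (((2 : ℕ) : ℝ) * s ^ (2 - 1) / 2) • g (w 0)) =
            (F (w s) - (F (w 0) + s • g (w 0))) - (h ^ 2 / 6) • A (w s) (g (w s)) := by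
          rw [map_sub, map_smul, hAv]
          norm_num
          abel
        rw [e]
        exact (norm_sub_le_of_le (hF s hs) (hAg _)).trans_eq (by ring)) ht
    convert this using 1
    · congr 1
      simp
      abel
    · ring
  have := norm_sub_sub_le_of_hasDerivAt (C := 6 * K ^ 2 * h ^ 3) (u := w)
    (p := fun t => t • v (w 0) + (t ^ 2 / 2) • F (w 0) + (t ^ 3 / 6) • g (w 0)
      - t • (h ^ 2 / 6) • g (w 0)) (by positivity) hw
    (fun s _ => ((((hasDerivAt_id s).smul_const (v (w 0))).add
      (((hasDerivAt_pow 2 s).div_const 2).smul_const (F (w 0)))).add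
      (((hasDerivAt_pow 3 s).div_const 6).smul_const (g (w 0)))).sub
      ((hasDerivAt_id s).smul_const _)) (fun s hs => by
      have e : v (w s) - (h ^ 2 / 6) • g (w s) -
          ((1 : ℝ) • v (w 0) + (((2 : ℕ) : ℝ) * s ^ (2 - 1) / 2) • F (w 0)
            + (((3 : ℕ) : ℝ) * s ^ (3 - 1) / 6) • g (w 0) - (1 : ℝ) • (h ^ 2 / 6) • g (w 0)) =
          (v (w s) - (v (w 0) + s • F (w 0) + (s ^ 2 / 2) • g (w 0)))
            - (h ^ 2 / 6) • (g (w s) - g (w 0)) := by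
        push_cast
        module
      rw [e]
      refine (norm_sub_le_of_le (hv s hs) (hεn _).le).trans ?_
      have hK2h : 0 ≤ K ^ 2 * h ^ 3 := by positivity
      nlinarith [mul_le_mul_of_nonneg_left (hg s hs) hε]) (Set.right_mem_Icc.2 h0)
  convert this using 1
  · congr 1
    module
  · ring

/-- The second-order Taylor method is a third-order approximation to its lowest-order
modified equation `ż = v - (h²/6)(v''(v,v) + v'v'v)`. -/
theorem taylor2_third_order_for_modified_equation
    {d : ℕ} (v : EuclideanSpace ℝ (Fin d) → EuclideanSpace ℝ (Fin d))
    (z₀ : EuclideanSpace ℝ (Fin d))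
    (hv : ContDiff ℝ 3 v)
    (hbdd : ∃ M : ℝ, ∀ z, ‖v z‖ ≤ M ∧ ‖fderiv ℝ v z‖ ≤ M ∧
      ‖iteratedFDeriv ℝ 2 v z‖ ≤ M ∧ ‖iteratedFDeriv ℝ 3 v z‖ ≤ M) :
    ∃ C > (0:ℝ), ∃ h₀ > (0:ℝ), ∀ h ∈ Set.Ioc (0:ℝ) h₀,
      ∀ w : ℝ → EuclideanSpace ℝ (Fin d), w 0 = z₀ →
        (∀ t ∈ Set.Icc (0:ℝ) h,
          HasDerivAt w
            (v (w t) - (h ^ 2 / 6) •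
              (iteratedFDeriv ℝ 2 v (w t) ![v (w t), v (w t)]
                + (fderiv ℝ v (w t)) ((fderiv ℝ v (w t)) (v (w t))))) t) →
        ‖w h - (z₀ + h • v z₀ + (h ^ 2 / 2) • (fderiv ℝ v z₀) (v z₀))‖ ≤ C * h ^ 4 := by
  obtain ⟨M, hM⟩ := hbdd
  have hd : Differentiable ℝ v := hv.differentiable (by norm_num)
  have hA : ContDiff ℝ 2 (fderiv ℝ v) := hv.fderiv_right (by norm_num)
  have hdA : Differentiable ℝ (fderiv ℝ v) := hA.differentiable (by norm_num)
  have hHM : ∀ z, ‖fderiv ℝ (fderiv ℝ v) z‖ ≤ M := fun z => by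
    rw [← norm_iteratedFDeriv_one, norm_iteratedFDeriv_fderiv]
    exact (hM z).2.2.1
  have bv : IsBoundedLipschitz v := .of_fderiv hd (fun z => (hM z).1) fun z => (hM z).2.1
  have bA : IsBoundedLipschitz (fderiv ℝ v) := .of_fderiv hdA (fun z => (hM z).2.1) hHM
  have bH : IsBoundedLipschitz (fderiv ℝ (fderiv ℝ v)) :=
    .fderiv_fderiv hv (fun z => (hM z).2.2.1) fun z => (hM z).2.2.2
  obtain ⟨K, hK, hgK, hgL⟩ :=
    ((bH.clm_apply bv).clm_apply bv).add (bA.clm_apply (bA.clm_apply bv))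
  have hM0 : 0 ≤ M := (norm_nonneg _).trans (hM 0).1
  have hL : 0 ≤ K + M + 2 * M ^ 2 := by positivity
  have hB : ∀ z, HasFDerivAt (fun z => fderiv ℝ v z (v z))
      ((fderiv ℝ v z).comp (fderiv ℝ v z) + (fderiv ℝ (fderiv ℝ v) z).flip (v z)) z :=
    fun z => (hdA z).hasFDerivAt.clm_apply (hd z).hasFDerivAt
  have hBM : ∀ z, ‖(fderiv ℝ v z).comp (fderiv ℝ v z)
      + (fderiv ℝ (fderiv ℝ v) z).flip (v z)‖ ≤ 2 * M ^ 2 := fun z => by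
    have h₁ := ((fderiv ℝ v z).opNorm_comp_le (fderiv ℝ v z)).trans
      (mul_le_mul (hM z).2.1 (hM z).2.1 (norm_nonneg _) hM0)
    have h₂ := (fderiv ℝ (fderiv ℝ v) z).flip.le_of_opNorm_le_of_le
      ((ContinuousLinearMap.opNorm_flip _).trans_le (hHM z)) (hM z).1
    exact (norm_add_le_of_le h₁ h₂).trans_eq (by ring)
  refine ⟨6 * (K + M + 2 * M ^ 2) ^ 2 + 1, by positivity, 1, one_pos, ?_⟩
  rintro h ⟨h0, h1⟩ w rfl hw
  have hKL : K ≤ K + M + 2 * M ^ 2 := by linarith [sq_nonneg M]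
  have hML : M ≤ K + M + 2 * M ^ 2 := by linarith [sq_nonneg M]
  have hM2L : 2 * M ^ 2 ≤ K + M + 2 * M ^ 2 := by linarith
  refine (norm_sub_taylor_le hL (fun z => (hd z).hasFDerivAt) hB (fun _ => rfl)
    (g := fun z => fderiv ℝ (fderiv ℝ v) z (v z) (v z) + fderiv ℝ v z (fderiv ℝ v z (v z)))
    (fun z => by simp [add_comm]) (fun z => (hM z).1.trans hML)
    (fun z => (hM z).2.1.trans hML) (fun z => (hBM z).trans hM2L)
    (fun z => (hgK z).trans hKL)
    (fun x y => (hgL x y).trans (mul_le_mul_of_nonneg_right hKL (norm_nonneg _)))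
    h0.le h1 (fun t ht => ?_)).trans ?_
  · simpa [iteratedFDeriv_two_apply] using hw t ht
  · exact mul_le_mul_of_nonneg_right (by linarith) (by positivity)
end

section
/- Let g : ℝ^ℓ → ℝ^ℓ be a bounded continuous vector field, let φ : ℝ → ℝ^ℓ → ℝ^ℓ be a flow of g (φ⁰ = id, φ^{t+s} = φᵗ ∘ φˢ for all s,t, and d/dt φᵗ(y) = g(φᵗ(y)) for all y,t), and let μ be a Borel probability measure on ℝ^ℓ such that φᵗ is measure-preserving for μ for every t ∈ ℝ. Let f₀ : ℝ^ℓ → ℝ be continuously differentiable with f₀ and its derivative bounded. Then for every t ≥ 0: ∫ f₀(y)·Df₀(φᵗ(y))(g(φᵗ(y))) dμ(y) + ∫ f₀(φᵗ(y))·Df₀(y)(g(y)) dμ(y) = 0. (This is the cancellation showing that the O(h) correction to the Green–Kubo diffusion formula in the backward error analysis of Euler's method integrates to zero.) -/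
open MeasureTheory

/-- Cancellation of the `O(h)` correction to the Green--Kubo diffusion formula in the
backward error analysis of Euler's method: for a flow `φ` of a bounded continuous vector
field `g` preserving a probability measure `μ`, and a bounded C¹ observable `f₀` with
bounded derivative,
`∫ f₀(y)·Df₀(φᵗy)(g(φᵗy)) dμ + ∫ f₀(φᵗy)·Df₀(y)(g(y)) dμ = 0` for every `t ≥ 0`. -/
theorem green_kubo_correction_cancels
    {ℓ : ℕ} (g : EuclideanSpace ℝ (Fin ℓ) → EuclideanSpace ℝ (Fin ℓ))
    (φ : ℝ → EuclideanSpace ℝ (Fin ℓ) → EuclideanSpace ℝ (Fin ℓ))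
    (μ : Measure (EuclideanSpace ℝ (Fin ℓ))) [IsProbabilityMeasure μ]
    (hg_cont : Continuous g)
    (hg_bdd : ∃ M : ℝ, ∀ y, ‖g y‖ ≤ M)
    (hφ0 : ∀ y, φ 0 y = y)
    (hgrp : ∀ (s t : ℝ) (y : EuclideanSpace ℝ (Fin ℓ)), φ (t + s) y = φ t (φ s y))
    (hflow : ∀ y t, HasDerivAt (fun s => φ s y) (g (φ t y)) t)
    (hinv : ∀ t : ℝ, MeasurePreserving (φ t) μ μ)
    (f₀ : EuclideanSpace ℝ (Fin ℓ) → ℝ)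
    (hf₀ : ContDiff ℝ 1 f₀)
    (hf₀_bdd : ∃ M : ℝ, ∀ y, |f₀ y| ≤ M ∧ ‖fderiv ℝ f₀ y‖ ≤ M) :
    ∀ t : ℝ, 0 ≤ t →
      (∫ y, f₀ y * (fderiv ℝ f₀ (φ t y)) (g (φ t y)) ∂μ)
        + (∫ y, f₀ (φ t y) * (fderiv ℝ f₀ y) (g y) ∂μ) = 0 := by
  obtain ⟨G, hG⟩ := hg_bdd
  obtain ⟨M, hM⟩ := hf₀_bdd
  intro t _
  have hM0 : 0 ≤ M := (abs_nonneg _).trans (hM 0).1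
  set D : EuclideanSpace ℝ (Fin ℓ) → ℝ := fun y => fderiv ℝ f₀ y (g y) with hD
  have hD_cont : Continuous D := (hf₀.continuous_fderiv one_ne_zero).clm_apply hg_cont
  have hD_bdd : ∀ y, |D y| ≤ M * G := fun y =>
    ((fderiv ℝ f₀ y).le_opNorm (g y)).trans
      (mul_le_mul (hM y).2 (hG y) (norm_nonneg _) hM0)
  have hf_meas : ∀ s, Measurable fun y => f₀ (φ s y) := fun s =>
    hf₀.continuous.measurable.comp (hinv s).measurable
  have hD_meas : ∀ s, Measurable fun y => D (φ s y) := fun s =>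
    hD_cont.measurable.comp (hinv s).measurable
  have hderiv : ∀ y s, HasDerivAt (fun r => f₀ (φ r y)) (D (φ s y)) s := fun y s =>
    ((hf₀.differentiable one_ne_zero (φ s y)).hasFDerivAt).comp_hasDerivAt s (hflow y s)
  have hfD_int : ∀ r s, Integrable (fun y => f₀ (φ r y) * D (φ s y)) μ := fun r s =>
    Integrable.of_bound ((hf_meas r).mul (hD_meas s)).aestronglyMeasurable (M * (M * G))
      (.of_forall fun y => by
        rw [Real.norm_eq_abs, abs_mul]
        exact mul_le_mul (hM _).1 (hD_bdd _) (abs_nonneg _) hM0)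
  have hff_int : Integrable (fun y => f₀ (φ 0 y) * f₀ (φ (t + 0) y)) μ :=
    Integrable.of_bound ((hf_meas 0).mul (hf_meas (t + 0))).aestronglyMeasurable (M * M)
      (.of_forall fun y => by
        rw [Real.norm_eq_abs, abs_mul]
        exact mul_le_mul (hM _).1 (hM _).1 (abs_nonneg _) hM0)
  have hmain := (hasDerivAt_integral_of_dominated_loc_of_deriv_le (μ := μ)
    (F := fun s y => f₀ (φ s y) * f₀ (φ (t + s) y))
    (F' := fun s y => D (φ s y) * f₀ (φ (t + s) y) + f₀ (φ s y) * D (φ (t + s) y))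
    (x₀ := (0 : ℝ)) (bound := fun _ => M * G * M + M * (M * G)) (s := Set.univ)
    Filter.univ_mem
    (.of_forall fun s => ((hf_meas s).mul (hf_meas (t + s))).aestronglyMeasurable)
    hff_int
    (((hD_meas 0).mul (hf_meas (t + 0))).add
      ((hf_meas 0).mul (hD_meas (t + 0)))).aestronglyMeasurable
    (.of_forall fun y s _ => by
      refine (norm_add_le _ _).trans ?_
      rw [Real.norm_eq_abs, Real.norm_eq_abs, abs_mul, abs_mul]
      exact add_le_add
        (mul_le_mul (hD_bdd _) (hM _).1 (abs_nonneg _) ((abs_nonneg _).trans (hD_bdd 0)))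
        (mul_le_mul (hM _).1 (hD_bdd _) (abs_nonneg _) hM0))
    (integrable_const _)
    (.of_forall fun y s _ =>
      (hderiv y s).mul ((hderiv y (t + s)).comp_const_add t s))).2
  have hconst : (fun s => ∫ y, f₀ (φ s y) * f₀ (φ (t + s) y) ∂μ)
      = fun _ => ∫ y, f₀ y * f₀ (φ t y) ∂μ := by
    funext s
    have h := integral_map (μ := μ) (hinv s).measurable.aemeasurable
      (f := fun y => f₀ y * f₀ (φ t y))
      (hf₀.continuous.measurable.mul (hf_meas t)).aestronglyMeasurable
    rw [(hinv s).map_eq] at h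
    simp only [hgrp, h]
  rw [hconst] at hmain
  have hzero := hmain.unique (hasDerivAt_const _ _)
  have h₁ := hfD_int 0 t
  have h₂ := hfD_int t 0
  simp only [hφ0, add_zero] at hzero h₁ h₂
  rw [← integral_add h₁ h₂, ← hzero]
  exact integral_congr_ae (.of_forall fun y => by simp only [hD]; ring)
end

section
/- Let g : ℝ^ℓ → ℝ^ℓ be a bounded, continuously differentiable vector field with bounded derivative, let φ : ℝ → ℝ^ℓ → ℝ^ℓ satisfy φ⁰(y) = y and d/dt φᵗ(y) = g(φᵗ(y)) for all y,t, and let μ be a Borel probability measure on ℝ^ℓ such that φᵗ is measure-preserving for μ for every t ∈ ℝ. Let f₀ : ℝ^ℓ → ℝ be continuously differentiable with f₀ and its derivative bounded, let f : ℝ × ℝ^ℓ → ℝ be such that y ↦ f(x,y) is twice continuously differentiable with bounded first and second derivatives in y, let h : ℝ → ℝ be continuously differentiable, and fix x ∈ ℝ. Then ∫ [ 3·h'(x)·h(x)·f₀(y)·Df₀(y)(g(y)) + D²_y f(x,y)(g(y), g(y)) + D_y f(x,y)(Dg(y)(g(y))) ] dμ(y) = 0. (This is the vanishing of the expected drift perturbation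 v₁^{drift} of the second-order Taylor method, showing that the method has no drift bias at order h².) -/
open MeasureTheory

/-- If `F` is the time derivative of a bounded observable `G` along a measure-preserving flow,
and `F` is bounded, then `F` has mean zero. -/
theorem integral_eq_zero_of_hasDerivAt_flow {X : Type*} [MeasurableSpace X] {μ : Measure X}
    [IsFiniteMeasure μ] {φ : ℝ → X → X} {G F : X → ℝ} {C : ℝ} (hφ0 : ∀ y, φ 0 y = y)
    (hinv : ∀ t, MeasurePreserving (φ t) μ μ) (hG : Integrable G μ)
    (hF : AEStronglyMeasurable F μ) (hF_bdd : ∀ y, ‖F y‖ ≤ C)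
    (hderiv : ∀ y t, HasDerivAt (fun s => G (φ s y)) (F (φ t y)) t) :
    ∫ y, F y ∂μ = 0 := by
  have hint : ∀ t, Integrable (fun y => G (φ t y)) μ := fun t =>
    (hinv t).integrable_comp_of_integrable hG
  have hconst : ∀ t, ∫ y, G (φ t y) ∂μ = ∫ y, G y ∂μ := fun t => by
    rw [← integral_map (hinv t).aemeasurable (by rw [(hinv t).map_eq]; exact hG.1),
      (hinv t).map_eq]
  have key := (hasDerivAt_integral_of_dominated_loc_of_deriv_le (μ := μ) (x₀ := (0 : ℝ))
    (F := fun t y => G (φ t y)) (F' := fun t y => F (φ t y)) (bound := fun _ => C)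
    Filter.univ_mem (.of_forall fun t => (hint t).1) (hint 0) (by simpa only [hφ0] using hF)
    (.of_forall fun y t _ => hF_bdd (φ t y)) (integrable_const C)
    (.of_forall fun y t _ => hderiv y t)).2
  simp only [hconst, hφ0] at key
  exact key.unique (hasDerivAt_const _ _)

/-- Vanishing of the expected drift perturbation of the second-order Taylor method:
`∫ [3 h'(x) h(x) f₀(y) Df₀(y)(g(y)) + D²_y f(x,y)(g(y),g(y)) + D_y f(x,y)(Dg(y)(g(y)))] dμ(y) = 0`,
so the method has no drift bias at order `h²`. -/
theorem taylor2_drift_perturbation_vanishes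
    {ℓ : ℕ} (g : EuclideanSpace ℝ (Fin ℓ) → EuclideanSpace ℝ (Fin ℓ))
    (φ : ℝ → EuclideanSpace ℝ (Fin ℓ) → EuclideanSpace ℝ (Fin ℓ))
    (μ : Measure (EuclideanSpace ℝ (Fin ℓ))) [IsProbabilityMeasure μ]
    (hg : ContDiff ℝ 1 g)
    (hg_bdd : ∃ M : ℝ, ∀ y, ‖g y‖ ≤ M ∧ ‖fderiv ℝ g y‖ ≤ M)
    (hφ0 : ∀ y, φ 0 y = y)
    (hflow : ∀ y t, HasDerivAt (fun s => φ s y) (g (φ t y)) t)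
    (hinv : ∀ t : ℝ, MeasurePreserving (φ t) μ μ)
    (f₀ : EuclideanSpace ℝ (Fin ℓ) → ℝ)
    (hf₀ : ContDiff ℝ 1 f₀)
    (hf₀_bdd : ∃ M : ℝ, ∀ y, |f₀ y| ≤ M ∧ ‖fderiv ℝ f₀ y‖ ≤ M)
    (f : ℝ × EuclideanSpace ℝ (Fin ℓ) → ℝ)
    (x : ℝ)
    (hf : ContDiff ℝ 2 (fun y => f (x, y)))
    (hf_bdd : ∃ M : ℝ, ∀ y, ‖fderiv ℝ (fun y' => f (x, y')) y‖ ≤ M ∧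
      ‖iteratedFDeriv ℝ 2 (fun y' => f (x, y')) y‖ ≤ M)
    (h : ℝ → ℝ)
    (hh : ContDiff ℝ 1 h) :
    ∫ y, (3 * deriv h x * h x * f₀ y * (fderiv ℝ f₀ y) (g y)
        + iteratedFDeriv ℝ 2 (fun y' => f (x, y')) y ![g y, g y]
        + (fderiv ℝ (fun y' => f (x, y')) y) ((fderiv ℝ g y) (g y))) ∂μ = 0 := by
  obtain ⟨M, hM⟩ := hg_bdd
  obtain ⟨M₀, hM₀⟩ := hf₀_bdd
  obtain ⟨M₁, hM₁⟩ := hf_bdd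
  have hM_nonneg : 0 ≤ M := (norm_nonneg _).trans (hM 0).1
  have hM₀_nonneg : 0 ≤ M₀ := (abs_nonneg _).trans (hM₀ 0).1
  have hM₁_nonneg : 0 ≤ M₁ := (norm_nonneg _).trans (hM₁ 0).1
  set u := fun y' => f (x, y')
  set c := deriv h x * h x with hc
  have hu' : ContDiff ℝ 1 (fderiv ℝ u) := hf.fderiv_right (by norm_num)
  have hcg := hg.continuous
  have hcdg := hg.continuous_fderiv one_ne_zero
  have hcf₀ := hf₀.continuous
  have hcdf₀ := hf₀.continuous_fderiv one_ne_zero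
  have hcdu := hu'.continuous
  have hcddu := hu'.continuous_fderiv one_ne_zero
  have hdu : ∀ y, |fderiv ℝ u y (g y)| ≤ M₁ * M := fun y =>
    (fderiv ℝ u y).le_of_opNorm_le_of_le (hM₁ y).1 (hM y).1
  refine integral_eq_zero_of_hasDerivAt_flow (φ := φ)
    (G := fun y => 3 / 2 * c * f₀ y ^ 2 + fderiv ℝ u y (g y))
    (C := 3 * |c| * M₀ * (M₀ * M) + M₁ * (M * M) + M₁ * (M * M)) hφ0 hinv ?_ ?_ ?_ ?_
  · refine .of_bound (C := 3 / 2 * |c| * M₀ ^ 2 + M₁ * M)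
      (by fun_prop : Continuous _).aestronglyMeasurable (.of_forall fun y => ?_)
    refine (norm_add_le _ _).trans (add_le_add ?_ (hdu y))
    rw [norm_mul, norm_mul, norm_pow, Real.norm_eq_abs, Real.norm_eq_abs, Real.norm_eq_abs,
      abs_of_pos (by norm_num : (0 : ℝ) < 3 / 2)]
    gcongr
    exact (hM₀ y).1
  · simp only [iteratedFDeriv_two_apply, Matrix.cons_val_zero, Matrix.cons_val_one]
    exact (by fun_prop : Continuous _).aestronglyMeasurable
  · intro y
    refine norm_add₃_le.trans (add_le_add_three ?_ ?_ ?_)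
    · rw [mul_assoc 3, norm_mul, norm_mul, norm_mul, Real.norm_eq_abs 3,
        abs_of_pos (by norm_num : (0 : ℝ) < 3), Real.norm_eq_abs c]
      gcongr
      · exact (hM₀ y).1
      · exact (fderiv ℝ f₀ y).le_of_opNorm_le_of_le (hM₀ y).2 (hM y).1
    · refine (ContinuousMultilinearMap.le_opNorm _ _).trans ?_
      simp only [Fin.prod_univ_two, Matrix.cons_val_zero, Matrix.cons_val_one]
      gcongr
      exacts [(hM₁ y).2, (hM y).1, (hM y).1]
    · exact (fderiv ℝ u y).le_of_opNorm_le_of_le (hM₁ y).1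
        ((fderiv ℝ g y).le_of_opNorm_le_of_le (hM y).2 (hM y).1)
  · intro y t
    have hφ := hflow y t
    have hf₀φ := (hf₀.differentiable one_ne_zero (φ t y)).hasFDerivAt.comp_hasDerivAt t hφ
    have hgφ := (hg.differentiable one_ne_zero (φ t y)).hasFDerivAt.comp_hasDerivAt t hφ
    have huφ := (hu'.differentiable one_ne_zero (φ t y)).hasFDerivAt.comp_hasDerivAt t hφ
    refine (((hf₀φ.pow 2).const_mul (3 / 2 * c)).add (huφ.clm_apply hgφ)).congr_deriv ?_
    simp only [iteratedFDeriv_two_apply, Matrix.cons_val_zero, Matrix.cons_val_one,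
      Function.comp_apply, hc]
    push_cast
    ring
end
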